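/- Let Σ be a symmetric positive definite real matrix indexed by V×V. Let a, c, z ∈ V be distinct and B ⊆ V \ {a, c, z}. Assume Σ_{az} = 0. Suppose there exist x ∈ V \ (B ∪ {a, c, z}) and z' ∈ V \ (B ∪ {a, c, z, x}) such that: σ_{uw|{x}} = 0 for every u ∈ {a, z} and every w ∈ {c} ∪ B; and σ_{z'u|{z}} = 0 for every u ∈ {a, c} ∪ B. Then ρ²_{ac|B} ≤ ρ²_{ac|B∪{z'}} ≤ ρ²_{ac|B∪{z}}. -/

import Mathlib

open Matrix

variable {V : Type*}

/-- Partial covariance `σ_{uv|Z} = Σ_{uv} − Σ_{uZ} (Σ_{ZZ})⁻¹ Σ_{Zv}`. -/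
noncomputable def pcov [Fintype V] [DecidableEq V] (S : Matrix V V ℝ) (u v : V) (Z : Finset V) : ℝ :=
  S u v - ∑ i : {x // x ∈ Z}, ∑ j : {x // x ∈ Z},
    S u (i : V) * (Matrix.of (fun i j : {x // x ∈ Z} => S (i : V) (j : V)))⁻¹ i j * S (j : V) v

/-- Squared partial correlation `ρ²_{uv|Z}`. -/
noncomputable def rho2 [Fintype V] [DecidableEq V] (S : Matrix V V ℝ) (u v : V) (Z : Finset V) : ℝ :=
  pcov S u v Z ^ 2 / (pcov S u u Z * pcov S v v Z)

/-- `β` is the vector of coefficients of the linear regression of `u` on `Z`. -/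
structure IsRegression [Fintype V] (S : Matrix V V ℝ) (u : V) (Z : Finset V) (β : V → ℝ) :
    Prop where
  support : ∀ j, j ∉ Z → β j = 0
  normal_eq : ∀ i ∈ Z, ∑ j, β j * S j i = S u i

section

variable {S : Matrix V V ℝ} {u v w : V} {Z : Finset V} {β γ : V → ℝ}

theorem posDef_principal (hpd : S.PosDef) (Z : Finset V) :
    (Matrix.of (fun i j : {x // x ∈ Z} => S (i : V) (j : V))).PosDef :=
  hpd.submatrix (e := fun i : {x // x ∈ Z} => (i : V)) Subtype.val_injective

variable [Fintype V]

theorem IsRegression.sum_mul (h : IsRegression S u Z β) (f : V → ℝ) :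
    ∑ j, β j * f j = ∑ j : {x // x ∈ Z}, β j * f j := by
  rw [Finset.sum_coe_sort Z (fun j => β j * f j)]
  refine (Finset.sum_subset (Finset.subset_univ Z) fun j _ hj => ?_).symm
  rw [h.support j hj, zero_mul]

variable [DecidableEq V]

theorem exists_isRegression (hpd : S.PosDef) (u : V) (Z : Finset V) :
    ∃ β, IsRegression S u Z β := by
  set M := Matrix.of (fun i j : {x // x ∈ Z} => S (i : V) (j : V)) with hM
  have hu : IsUnit M.det := (posDef_principal hpd Z).det_pos.ne'.isUnit
  set b := (fun i : {x // x ∈ Z} => S u i) ᵥ* M⁻¹ with hb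
  have hbM : b ᵥ* M = fun i : {x // x ∈ Z} => S u i := by
    rw [hb, Matrix.vecMul_vecMul, Matrix.nonsing_inv_mul M hu, Matrix.vecMul_one]
  refine ⟨fun j => if h : j ∈ Z then b ⟨j, h⟩ else 0, fun j hj => dif_neg hj, fun i hi => ?_⟩
  rw [← congrFun hbM ⟨i, hi⟩, ← Finset.sum_subset (Finset.subset_univ Z)
    (fun j _ hj => by rw [dif_neg hj, zero_mul]), ← Finset.sum_coe_sort Z]
  simp [Matrix.vecMul, dotProduct, hM]

theorem IsRegression.pcov_eq (hpd : S.PosDef) (h : IsRegression S u Z β) (v : V) :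
    pcov S u v Z = S u v - ∑ j, β j * S j v := by
  set M := Matrix.of (fun i j : {x // x ∈ Z} => S (i : V) (j : V)) with hM
  have hu : IsUnit M.det := (posDef_principal hpd Z).det_pos.ne'.isUnit
  have hβ : (fun i : {x // x ∈ Z} => S u i) ᵥ* M⁻¹ = fun i : {x // x ∈ Z} => β i := by
    have : (fun i : {x // x ∈ Z} => S u i) = (fun i : {x // x ∈ Z} => β i) ᵥ* M := by
      ext i
      rw [← h.normal_eq i i.2, h.sum_mul]
      simp [Matrix.vecMul, dotProduct, hM]
    rw [this, Matrix.vecMul_vecMul, Matrix.mul_nonsing_inv M hu, Matrix.vecMul_one]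
  rw [pcov, h.sum_mul, Finset.sum_comm]
  congr 1
  refine Finset.sum_congr rfl fun j _ => ?_
  rw [← congrFun hβ j, ← Finset.sum_mul]
  rfl

theorem IsRegression.sum_mul_comm (hsym : S.IsSymm) (hu : IsRegression S u Z β)
    (hv : IsRegression S v Z γ) : ∑ j, β j * S j v = ∑ j, γ j * S j u := by
  have key : ∀ {u v : V} {β γ : V → ℝ}, IsRegression S u Z β → IsRegression S v Z γ →
      ∑ j, β j * S j v = ∑ j, ∑ k, β j * (γ k * S k j) := by
    intro u v β γ hu hv
    refine Finset.sum_congr rfl fun j _ => ?_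
    by_cases hj : j ∈ Z
    · rw [← Finset.mul_sum, hv.normal_eq j hj, hsym.apply]
    · simp [hu.support j hj]
  rw [key hu hv, key hv hu, Finset.sum_comm]
  refine Finset.sum_congr rfl fun j _ => Finset.sum_congr rfl fun k _ => ?_
  rw [hsym.apply]
  ring

theorem IsRegression.sum_mul_self_nonneg (hsym : S.IsSymm) (hpd : S.PosDef)
    (h : IsRegression S u Z β) : 0 ≤ ∑ j, β j * S j u := by
  refine (hpd.posSemidef.dotProduct_mulVec_nonneg β).trans_eq ?_
  symm
  simp only [dotProduct, Matrix.mulVec, star_trivial]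
  refine Finset.sum_congr rfl fun j _ => ?_
  by_cases hj : j ∈ Z
  · rw [hsym.apply u j, ← h.normal_eq j hj]
    congr 1
    refine Finset.sum_congr rfl fun k _ => ?_
    rw [hsym.apply, mul_comm]
  · simp [h.support j hj]

theorem pcov_comm (hsym : S.IsSymm) (hpd : S.PosDef) (u v : V) (Z : Finset V) :
    pcov S u v Z = pcov S v u Z := by
  obtain ⟨β, hβ⟩ := exists_isRegression hpd u Z
  obtain ⟨γ, hγ⟩ := exists_isRegression hpd v Z
  rw [hβ.pcov_eq hpd, hγ.pcov_eq hpd, hβ.sum_mul_comm hsym hγ, hsym.apply]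

theorem pcov_self_pos (hsym : S.IsSymm) (hpd : S.PosDef) (hu : u ∉ Z) : 0 < pcov S u u Z := by
  obtain ⟨β, hβ⟩ := exists_isRegression hpd u Z
  set f : V → ℝ := Pi.single u 1 - β with hf
  have hfu : f u = 1 := by simp [hf, hβ.support u hu]
  have hpos := hpd.dotProduct_mulVec_pos (x := f) (fun h => by simp [h] at hfu)
  have hSf : ∀ i, (S *ᵥ f) i = S u i - ∑ j, β j * S j i := by
    intro i
    simp only [hf, Matrix.mulVec_sub, Pi.sub_apply, Matrix.mulVec_single_one, Matrix.col_apply]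
    rw [hsym.apply]
    congr 1
    refine Finset.sum_congr rfl fun j _ => ?_
    rw [hsym.apply, mul_comm]
  rw [hβ.pcov_eq hpd, ← hSf]
  have : star f ⬝ᵥ S *ᵥ f = (S *ᵥ f) u := by
    rw [dotProduct, Finset.sum_eq_single u]
    · simp [hfu]
    · intro j _ hj
      by_cases hjZ : j ∈ Z
      · rw [hSf, hβ.normal_eq j hjZ, sub_self, mul_zero]
      · simp [hf, hβ.support j hjZ, hj]
    · simp
  rwa [this] at hpos

theorem pcov_insert (hsym : S.IsSymm) (hpd : S.PosDef) (hw : w ∉ Z) (u v : V) :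
    pcov S u v (insert w Z) =
      pcov S u v Z - pcov S u w Z * pcov S w v Z / pcov S w w Z := by
  have hww := (pcov_self_pos hsym hpd hw).ne'
  obtain ⟨β, hβ⟩ := exists_isRegression hpd u Z
  obtain ⟨γ, hγ⟩ := exists_isRegression hpd w Z
  set l := pcov S u w Z / pcov S w w Z with hl
  have hsum : ∀ i, ∑ j, (β j + l * ((Pi.single w 1 : V → ℝ) j - γ j)) * S j i =
      (∑ j, β j * S j i) + l * (S w i - ∑ j, γ j * S j i) := by
    intro i
    simp only [add_mul, mul_assoc, sub_mul, Finset.sum_add_distrib, ← Finset.mul_sum,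
      Finset.sum_sub_distrib]
    simp [Pi.single_apply]
  have hreg : IsRegression S u (insert w Z)
      (fun j => β j + l * ((Pi.single w 1 : V → ℝ) j - γ j)) := by
    refine ⟨fun j hj => ?_, fun i hi => ?_⟩
    · rw [Finset.mem_insert, not_or] at hj
      simp [hβ.support j hj.2, hγ.support j hj.2, hj.1]
    · rw [hsum]
      rcases Finset.mem_insert.1 hi with rfl | hi
      · rw [← hγ.pcov_eq hpd, hl, div_mul_cancel₀ _ hww, hβ.pcov_eq hpd]
        ring
      · rw [hβ.normal_eq i hi, hγ.normal_eq i hi]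
        ring
  rw [hreg.pcov_eq hpd, hsum, hβ.pcov_eq hpd v, hγ.pcov_eq hpd v, hl]
  ring

theorem pcov_singleton (hpd : S.PosDef) (u v w : V) :
    pcov S u v {w} = S u v - S u w / S w w * S w v := by
  have hww : S w w ≠ 0 := hpd.diag_pos.ne'
  have hreg : IsRegression S u {w} (Pi.single w (S u w / S w w)) := by
    refine ⟨fun j hj => ?_, fun i hi => ?_⟩
    · rw [Finset.mem_singleton] at hj
      simp [hj]
    · rw [Finset.mem_singleton] at hi
      simp [Pi.single_apply, hi, hww]
  rw [hreg.pcov_eq hpd]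
  simp [Pi.single_apply]

/-- The squared partial correlation as a function of `t = η² / Σ_{ww}`, when `Σ_{aw} = 0` and the
covariances of `a` and `w` with `insert c B` are `α` and `η` times those of `x`. Here
`q = Σ_{xx} - σ_{xx|B}`. -/
theorem rho2_insert_of_proportional (hsym : S.IsSymm) (hpd : S.PosDef) {a c x w : V}
    {B : Finset V} {α η : ℝ} (haw : a ≠ w) (haB : a ∉ B) (hcB : c ∉ B) (hcw : c ≠ w) (hwB : w ∉ B)
    (hSaw : S a w = 0) (ha : ∀ b ∈ insert c B, S a b = α * S x b)
    (hw : ∀ b ∈ insert c B, S w b = η * S x b) :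
    0 < pcov S a a B - S a a * (S x x - pcov S x x B) * (η ^ 2 / S w w) ∧
    0 < pcov S c c B - (pcov S c c B * (S x x - pcov S x x B) + pcov S x c B ^ 2) *
      (η ^ 2 / S w w) ∧
    rho2 S a c (insert w B) = pcov S a c B ^ 2 /
      ((pcov S a a B - S a a * (S x x - pcov S x x B) * (η ^ 2 / S w w)) *
      (pcov S c c B - (pcov S c c B * (S x x - pcov S x x B) + pcov S x c B ^ 2) *
        (η ^ 2 / S w w))) := by
  obtain ⟨β, hβ⟩ := exists_isRegression hpd x B
  have hβB : ∀ {u : V} {k : ℝ}, (∀ b ∈ insert c B, S u b = k * S x b) →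
      IsRegression S u B (fun j => k * β j) ∧ ∑ j, β j * S j u = k * ∑ j, β j * S j x := by
    intro u k hu
    refine ⟨⟨fun j hj => by rw [hβ.support j hj, mul_zero], fun i hi => ?_⟩, ?_⟩
    · simp only [mul_assoc, ← Finset.mul_sum]
      rw [hβ.normal_eq i hi, hu i (Finset.mem_insert_of_mem hi)]
    · rw [Finset.mul_sum]
      refine Finset.sum_congr rfl fun j _ => ?_
      by_cases hj : j ∈ B
      · rw [hsym.apply u j, hu j (Finset.mem_insert_of_mem hj), hsym.apply j x]
        ring
      · simp [hβ.support j hj]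
  obtain ⟨hra, hqa⟩ := hβB ha
  obtain ⟨hrw, hqw⟩ := hβB hw
  have hq : S x x - pcov S x x B = ∑ j, β j * S j x := by
    rw [hβ.pcov_eq hpd]; ring
  have hxc := hβ.pcov_eq hpd c
  have hac' : pcov S a c B = α * pcov S x c B := by
    rw [hra.pcov_eq hpd, hxc, ha c (Finset.mem_insert_self c B)]
    simp only [mul_assoc, ← Finset.mul_sum]; ring
  have hwc' : pcov S w c B = η * pcov S x c B := by
    rw [hrw.pcov_eq hpd, hxc, hw c (Finset.mem_insert_self c B)]
    simp only [mul_assoc, ← Finset.mul_sum]; ring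
  have haa' : pcov S a a B = S a a - α ^ 2 * (S x x - pcov S x x B) := by
    rw [hra.pcov_eq hpd, hq]
    simp only [mul_assoc, ← Finset.mul_sum]
    rw [hqa]; ring
  have hww' : pcov S w w B = S w w - η ^ 2 * (S x x - pcov S x x B) := by
    rw [hrw.pcov_eq hpd, hq]
    simp only [mul_assoc, ← Finset.mul_sum]
    rw [hqw]; ring
  have haw' : pcov S a w B = -(α * η * (S x x - pcov S x x B)) := by
    rw [hra.pcov_eq hpd, hq, hSaw]
    simp only [mul_assoc, ← Finset.mul_sum]
    rw [hqw]; ring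
  have hwa' := pcov_comm hsym hpd w a B
  have hcw' := pcov_comm hsym hpd c w B
  have hSww : 0 < S w w := hpd.diag_pos
  have hD : 0 < pcov S w w B := pcov_self_pos hsym hpd hwB
  have hpa : 0 < pcov S a a (insert w B) := pcov_self_pos hsym hpd (by simp [haw, haB])
  have hpc : 0 < pcov S c c (insert w B) := pcov_self_pos hsym hpd (by simp [hcw, hcB])
  have e1 : pcov S a c (insert w B) = pcov S a c B * (S w w / pcov S w w B) := by
    rw [pcov_insert hsym hpd hwB, hwc', haw', hac']
    field_simp
    rw [hww']; ring
  have e2 : pcov S a a (insert w B) =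
      (pcov S a a B - S a a * (S x x - pcov S x x B) * (η ^ 2 / S w w)) *
        (S w w / pcov S w w B) := by
    rw [pcov_insert hsym hpd hwB, hwa', haw', haa']
    field_simp
    rw [hww']; ring
  have e3 : pcov S c c (insert w B) =
      (pcov S c c B - (pcov S c c B * (S x x - pcov S x x B) + pcov S x c B ^ 2) *
        (η ^ 2 / S w w)) * (S w w / pcov S w w B) := by
    rw [pcov_insert hsym hpd hwB, hcw', hwc']
    field_simp
    rw [hww']; ring
  have hk : 0 < S w w / pcov S w w B := div_pos hSww hD
  rw [e2] at hpa
  rw [e3] at hpc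
  have h1 := pos_of_mul_pos_left hpa hk.le
  have h2 := pos_of_mul_pos_left hpc hk.le
  refine ⟨h1, h2, ?_⟩
  rw [rho2, e1, e2, e3, mul_pow, mul_mul_mul_comm, ← pow_two (S w w / _),
    mul_div_mul_right _ _ (pow_pos hk 2).ne']

theorem sq_div_mul_le_sq_div_mul_of_le {k A s m n t₁ t₂ : ℝ} (hm : 0 ≤ m) (hn : 0 ≤ n)
    (ht : t₁ ≤ t₂) (h1 : 0 < A - m * t₂) (h2 : 0 < s - n * t₂) :
    k ^ 2 / ((A - m * t₁) * (s - n * t₁)) ≤ k ^ 2 / ((A - m * t₂) * (s - n * t₂)) := by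
  have h3 := mul_le_mul_of_nonneg_left ht hm
  have h4 := mul_le_mul_of_nonneg_left ht hn
  have h5 : 0 ≤ A - m * t₁ := by linarith
  gcongr

theorem sq_apply_le_mul_diag (hsym : S.IsSymm) (hpd : S.PosDef) (huv : u ≠ v) :
    S u v ^ 2 ≤ S u u * S v v := by
  have h := pcov_self_pos hsym hpd (Z := {v}) (u := u) (by simpa using huv)
  have hv : 0 < S v v := hpd.diag_pos
  rw [pcov_singleton hpd, hsym.apply u v] at h
  have := mul_pos h hv
  field_simp at this
  linarith

end

/-- Theorem 4 (ii), second part: with `a ⟂⟂ z`, `{a,z} ⟂⟂ {c} ∪ B | x`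
and `z' ⟂⟂ {a,c} ∪ B | z`, one has `ρ²_{ac|B} ≤ ρ²_{ac|B∪{z'}} ≤ ρ²_{ac|B∪{z}}`. -/
theorem stmt_8 [Fintype V] [DecidableEq V] [Nonempty V]
    (S : Matrix V V ℝ) (hsym : S.IsSymm) (hpd : S.PosDef)
    (a c z : V) (hac : a ≠ c) (haz : a ≠ z) (hcz : c ≠ z)
    (B : Finset V) (haB : a ∉ B) (hcB : c ∉ B) (hzB : z ∉ B)
    (hSaz : S a z = 0)
    (z' : V) (hz'B : z' ∉ B) (hz'a : z' ≠ a) (hz'c : z' ≠ c) (hz'z : z' ≠ z)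
    (h : ∃ x : V, x ∉ B ∧ x ≠ a ∧ x ≠ c ∧ x ≠ z ∧ x ≠ z' ∧
      ∀ u ∈ ({a, z} : Finset V), ∀ w ∈ insert c B, pcov S u w {x} = 0)
    (h' : ∀ u ∈ insert a (insert c B), pcov S z' u {z} = 0) :
    rho2 S a c B ≤ rho2 S a c (insert z' B) ∧
      rho2 S a c (insert z' B) ≤ rho2 S a c (insert z B) := by
  obtain ⟨x, -, -, -, -, -, hx⟩ := h
  have hprop : ∀ u ∈ ({a, z} : Finset V), ∀ b ∈ insert c B, S u b = S u x / S x x * S x b := by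
    intro u hu b hb
    have := hx u hu b hb
    rw [pcov_singleton hpd] at this
    linarith
  have hpa := hprop a (by simp)
  have hpz := hprop z (by simp)
  have hprop' : ∀ u ∈ insert a (insert c B), S z' u = S z' z / S z z * S z u := by
    intro u hu
    have := h' u hu
    rw [pcov_singleton hpd] at this
    linarith
  have hSaz' : S a z' = 0 := by
    rw [hsym.apply z' a, hprop' a (by simp), hsym.apply a z, hSaz, mul_zero]
  have hpz' : ∀ b ∈ insert c B, S z' b = S z' z / S z z * (S z x / S x x) * S x b := by
    intro b hb
    rw [hprop' b (Finset.mem_insert_of_mem hb), hpz b hb]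
    ring
  obtain ⟨h1, h2, e⟩ :=
    rho2_insert_of_proportional hsym hpd haz haB hcB hcz hzB hSaz hpa hpz
  obtain ⟨h1', h2', e'⟩ :=
    rho2_insert_of_proportional hsym hpd hz'a.symm haB hcB hz'c.symm hz'B hSaz' hpa hpz'
  have hSzz : 0 < S z z := hpd.diag_pos
  have hSz'z' : 0 < S z' z' := hpd.diag_pos
  have hq : 0 ≤ S x x - pcov S x x B := by
    obtain ⟨β, hβ⟩ := exists_isRegression hpd x B
    have := hβ.sum_mul_self_nonneg hsym hpd
    rw [hβ.pcov_eq hpd]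
    linarith
  have hm : 0 ≤ S a a * (S x x - pcov S x x B) := mul_nonneg hpd.diag_pos.le hq
  have hn : 0 ≤ pcov S c c B * (S x x - pcov S x x B) + pcov S x c B ^ 2 :=
    add_nonneg (mul_nonneg (pcov_self_pos hsym hpd hcB).le hq) (sq_nonneg _)
  rw [e, e']
  constructor
  · have := sq_div_mul_le_sq_div_mul_of_le (k := pcov S a c B) hm hn
      (div_nonneg (sq_nonneg (S z' z / S z z * (S z x / S x x))) hSz'z'.le) h1' h2'
    simpa [rho2] using this
  · refine sq_div_mul_le_sq_div_mul_of_le hm hn ?_ h1 h2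
    have hcs := sq_apply_le_mul_diag hsym hpd hz'z
    rw [div_le_div_iff₀ hSz'z' hSzz, mul_pow, div_pow]
    calc S z' z ^ 2 / S z z ^ 2 * (S z x / S x x) ^ 2 * S z z
        = (S z x / S x x) ^ 2 * (S z' z ^ 2 / S z z) := by field_simp
      _ ≤ (S z x / S x x) ^ 2 * S z' z' := by
        gcongr
        rwa [div_le_iff₀ hSzz]
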